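/- Let G be a simple graph on n vertices, let e be an edge of G and H = G − e, and let λ_1 ≥ ⋯ ≥ λ_n and θ_1 ≥ ⋯ ≥ θ_n denote the eigenvalues of the adjacency matrices A(G) and A(H), respectively. Suppose H has exactly r ≥ 2 positive eigenvalues. Then for every real number p ≥ 1, λ_1^p + Σ_{k=2}^{r} max{λ_k, 0}^p ≥ (Σ_{k=1}^{r} θ_k^p) + max{θ_2 − 1, 0}^p − θ_2^p. -/

import Mathlib

open Polynomial

/-- Adjacency matrix of a simple graph over ℝ (using classical decidability). -/
noncomputable def adjMat {V : Type*} [Fintype V] (G : SimpleGraph V) : Matrix V V ℝ :=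
  letI := Classical.decRel G.Adj
  SimpleGraph.adjMatrix ℝ G

lemma exists_eigenbasis {n : ℕ} (A : Matrix (Fin n) (Fin n) ℝ) (hA : A.IsHermitian)
    (lam : ℕ → ℝ) (hmono : Antitone lam)
    (hlam : A.charpoly.roots = (Multiset.range n).map lam) :
    ∃ v : OrthonormalBasis (Fin n) ℝ (EuclideanSpace ℝ (Fin n)),
      ∀ i : Fin n, Matrix.toEuclideanLin A (v i) = lam i • v i := by
  have hT := Matrix.isSymmetric_toEuclideanLin_iff.mpr hA
  have hn : Module.finrank ℝ (EuclideanSpace ℝ (Fin n)) = n := by simp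
  have hch : (Matrix.toEuclideanLin A).charpoly = A.charpoly := by
    rw [Matrix.toEuclideanLin, Matrix.toLpLin_eq_toLin, Matrix.charpoly_toLin]
  have h1 := hT.sort_roots_charpoly_eq_eigenvalues hn
  rw [hch, hlam] at h1
  have h2 : (Multiset.range n).map lam = ((List.ofFn fun i : Fin n => lam i) : Multiset ℝ) := by
    rw [← Multiset.coe_range, Multiset.map_coe, List.ofFn_eq_map]
    congr 1
    rw [← List.map_coe_finRange_eq_range, List.map_map]; rfl
  have h3 : List.ofFn (fun i : Fin n => lam i) = List.ofFn (hT.eigenvalues hn) := by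
    rw [← h1, h2]
    simp only [Multiset.map_coe, Multiset.coe_sort, RCLike.re_to_real, List.map_id']
    symm
    apply List.mergeSort_of_pairwise
    simp_rw [decide_eq_true_eq, ← List.sortedGE_iff_pairwise]
    refine Antitone.sortedGE_ofFn ?_
    intro i j hij
    exact hmono hij
  have h4 := List.ofFn_injective h3
  refine ⟨hT.eigenvectorBasis hn, fun i => ?_⟩
  rw [hT.apply_eigenvectorBasis hn i, congrFun h4 i]
  rfl

section abs
variable {E : Type*} [NormedAddCommGroup E] [InnerProductSpace ℝ E]

lemma quad_eq {n : ℕ} (T : E →ₗ[ℝ] E) (v : OrthonormalBasis (Fin n) ℝ E) (lam : ℕ → ℝ)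
    (hv : ∀ i : Fin n, T (v i) = lam i • v i) (x : E) :
    inner ℝ x (T x) = ∑ i : Fin n, lam i * inner ℝ x (v i) ^ 2 := by
  conv_lhs => rw [← v.sum_repr' x, map_sum, v.sum_repr' x, inner_sum]
  refine Finset.sum_congr rfl fun i _ => ?_
  rw [map_smul, hv, inner_smul_right, inner_smul_right, real_inner_comm x (v i)]
  ring

lemma kyfan {n : ℕ} (T : E →ₗ[ℝ] E) (v u : OrthonormalBasis (Fin n) ℝ E) (lam : ℕ → ℝ)
    (hmono : Antitone lam)
    (hv : ∀ i : Fin n, T (v i) = lam i • v i) (s : Finset (Fin n)) (k : ℕ)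
    (hs : ∀ i, i ∈ s ↔ i.1 < k) :
    ∑ i ∈ s, inner ℝ (u i) (T (u i)) ≤ ∑ i ∈ s, lam i := by
  simp_rw [quad_eq T v lam hv]
  rw [Finset.sum_comm]
  simp_rw [← Finset.mul_sum]
  set w : Fin n → ℝ := fun j => ∑ i ∈ s, inner ℝ (u i) (v j) ^ 2 with hw
  have hw0 : ∀ j, 0 ≤ w j := fun j => Finset.sum_nonneg fun i _ => sq_nonneg _
  have hw1 : ∀ j, w j ≤ 1 := fun j => by
    have := u.orthonormal.sum_inner_products_le (v j) (s := s)
    simpa using this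
  have hws : ∑ j, w j = s.card := by
    rw [hw, Finset.sum_comm]
    simp [OrthonormalBasis.sum_sq_inner_left]
  have key : ∑ j : Fin n, (lam j - lam (k-1)) * w j ≤ ∑ j ∈ s, (lam j - lam (k-1)) := by
    have : ∑ j ∈ s, (lam j - lam (k-1)) =
        ∑ j : Fin n, if j ∈ s then (lam j - lam (k-1)) else 0 := by
      simp [Finset.sum_ite_mem]
    rw [this]
    refine Finset.sum_le_sum fun j _ => ?_
    split_ifs with hj
    · have h1 : lam (k-1) ≤ lam j := hmono (by have := (hs j).1 hj; omega)
      nlinarith [hw0 j, hw1 j]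
    · have h1 : lam j ≤ lam (k-1) := hmono (by have := mt (hs j).2 hj; omega)
      nlinarith [hw0 j, hw1 j]
  have e1 : ∑ j : Fin n, (lam j - lam (k-1)) * w j = ∑ j : Fin n, lam j * w j - lam (k-1) * s.card := by
    simp_rw [sub_mul]
    rw [Finset.sum_sub_distrib, ← Finset.mul_sum, hws]
  rw [e1, Finset.sum_sub_distrib] at key
  simp only [Finset.sum_const, nsmul_eq_mul] at key
  linarith

lemma interlace {n : ℕ} (S T : E →ₗ[ℝ] E) (v u : OrthonormalBasis (Fin n) ℝ E) (lam θ : ℕ → ℝ)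
    (hmono : Antitone lam) (hmono' : Antitone θ)
    (hv : ∀ i : Fin n, T (v i) = lam i • v i) (hu : ∀ i : Fin n, S (u i) = θ i • u i)
    (φ : E →ₗ[ℝ] ℝ) (hφ : ∀ x, φ x = 0 → inner ℝ x (S x) = inner ℝ x (T x))
    (i : ℕ) (hi : i + 1 < n) : θ (i+1) ≤ lam i := by
  have : FiniteDimensional ℝ E := Module.Basis.finiteDimensional_of_finite v.toBasis
  have hn : Module.finrank ℝ E = n := by simpa using Module.finrank_eq_card_basis v.toBasis
  -- conditions: orthogonal to `v j` for `j < i`, to `u j` for `j > i+1`, and `φ x = 0`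
  let f : E →ₗ[ℝ] (({j : Fin n // j.1 < i} → ℝ) × ({j : Fin n // i + 1 < j.1} → ℝ) × ℝ) :=
    (LinearMap.pi fun j => innerₛₗ ℝ (v j.1)).prod
      ((LinearMap.pi fun j => innerₛₗ ℝ (u j.1)).prod φ)
  have hker : LinearMap.ker f ≠ ⊥ := by
    apply LinearMap.ker_ne_bot_of_finrank_lt
    have c1 : Fintype.card {j : Fin n // j.1 < i} = i := by
      rw [Fintype.card_subtype]
      have := Fin.card_filter_val_lt (n := n) (m := i)
      omega
    have c2 : Fintype.card {j : Fin n // i + 1 < j.1} = n - (i + 2) := by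
      rw [Fintype.card_subtype]
      have := Fin.card_Ioi (⟨i+1, hi⟩ : Fin n)
      have e : (Finset.univ.filter fun j : Fin n => i + 1 < j.1) = Finset.Ioi ⟨i+1, hi⟩ := by
        ext j; simp [Fin.lt_def]
      rw [e, this]; simp; omega
    simp [c1, c2, hn]
    omega
  obtain ⟨x, hx, hx0⟩ := Submodule.exists_mem_ne_zero_of_ne_bot hker
  have hx' : (∀ j : Fin n, j.1 < i → inner ℝ (v j) x = 0) ∧
      (∀ j : Fin n, i + 1 < j.1 → inner ℝ (u j) x = 0) ∧ φ x = 0 := by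
    have hf : f x = 0 := hx
    refine ⟨fun j hj => congrFun (congrArg Prod.fst hf) ⟨j, hj⟩,
      fun j hj => congrFun (congrArg (fun q => q.2.1) hf) ⟨j, hj⟩, congrArg (fun q => q.2.2) hf⟩
  obtain ⟨h1, h2, h3⟩ := hx'
  have hST := hφ x h3
  rw [quad_eq S u θ hu, quad_eq T v lam hv] at hST
  have hA : θ (i+1) * ‖x‖^2 ≤ ∑ j : Fin n, θ j * inner ℝ x (u j) ^ 2 := by
    rw [← u.sum_sq_inner_left x, Finset.mul_sum]
    refine Finset.sum_le_sum fun j _ => ?_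
    by_cases hj : i + 1 < j.1
    · rw [real_inner_comm, h2 j hj]; simp
    · exact mul_le_mul_of_nonneg_right (hmono' (by omega)) (sq_nonneg _)
  have hB : ∑ j : Fin n, lam j * inner ℝ x (v j) ^ 2 ≤ lam i * ‖x‖^2 := by
    rw [← v.sum_sq_inner_left x, Finset.mul_sum]
    refine Finset.sum_le_sum fun j _ => ?_
    by_cases hj : j.1 < i
    · rw [real_inner_comm, h1 j hj]; simp
    · exact mul_le_mul_of_nonneg_right (hmono (by omega)) (sq_nonneg _)
  have hp : 0 < ‖x‖^2 := by positivity
  exact le_of_mul_le_mul_right (by linarith) hp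

end abs

lemma rpow_tangent {a b p : ℝ} (ha : 0 ≤ a) (hb : 0 ≤ b) (hp : 1 ≤ p) :
    p * a ^ (p - 1) * (b - a) ≤ b ^ p - a ^ p := by
  rcases ha.eq_or_lt with rfl | ha
  · rcases hp.eq_or_lt with rfl | hp'
    · simp
    · rw [Real.zero_rpow (by linarith), Real.zero_rpow (by linarith)]
      simp; positivity
  · have h := one_add_mul_self_le_rpow_one_add (s := b / a - 1) (by
      have : 0 ≤ b / a := by positivity
      linarith) hp
    have e : (1 + (b / a - 1)) ^ p = b ^ p / a ^ p := by
      rw [add_sub_cancel, Real.div_rpow hb ha.le]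
    have hap : 0 < a ^ p := Real.rpow_pos_of_pos ha p
    rw [e, le_div_iff₀ hap] at h
    rw [Real.rpow_sub_one ha.ne']
    have : p * (a ^ p / a) * (b - a) = (1 + p * (b / a - 1)) * a ^ p - a ^ p := by
      field_simp; ring
    linarith

lemma abel_nonneg (c d : ℕ → ℝ) (r : ℕ) (hc0 : ∀ i < r, 0 ≤ c i)
    (hc : ∀ i, i + 1 < r → c (i+1) ≤ c i)
    (hd : ∀ k ≤ r, 0 ≤ ∑ i ∈ Finset.range k, d i) :
    0 ≤ ∑ i ∈ Finset.range r, c i * d i := by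
  have key : ∀ k, k + 1 ≤ r →
      c k * ∑ i ∈ Finset.range (k+1), d i ≤ ∑ i ∈ Finset.range (k+1), c i * d i := by
    intro k
    induction k with
    | zero => intro _; simp
    | succ k ih =>
      intro hk
      rw [Finset.sum_range_succ, Finset.sum_range_succ (fun i => c i * d i)]
      have h1 := ih (by omega)
      have h2 := mul_le_mul_of_nonneg_right (hc k (by omega)) (hd (k+1) (by omega))
      linarith
  rcases r with _ | r
  · simp
  · exact le_trans (mul_nonneg (hc0 r (by omega)) (hd _ le_rfl)) (key r le_rfl)

lemma weak_major (a b : ℕ → ℝ) (r : ℕ) (ha0 : ∀ i < r, 0 ≤ a i) (hb0 : ∀ i < r, 0 ≤ b i)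
    (ha : ∀ i, i + 1 < r → a (i+1) ≤ a i)
    (h : ∀ k ≤ r, ∑ i ∈ Finset.range k, a i ≤ ∑ i ∈ Finset.range k, b i)
    (p : ℝ) (hp : 1 ≤ p) :
    ∑ i ∈ Finset.range r, a i ^ p ≤ ∑ i ∈ Finset.range r, b i ^ p := by
  have h1 := abel_nonneg (fun i => p * a i ^ (p-1)) (fun i => b i - a i) r
    (fun i hi => mul_nonneg (by linarith) (Real.rpow_nonneg (ha0 i hi) _))
    (fun i hi => mul_le_mul_of_nonneg_left
      (Real.rpow_le_rpow (ha0 _ hi) (ha i hi) (by linarith)) (by linarith))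
    (fun k hk => by rw [Finset.sum_sub_distrib]; linarith [h k hk])
  have h2 : ∑ i ∈ Finset.range r, p * a i ^ (p-1) * (b i - a i) ≤
      ∑ i ∈ Finset.range r, (b i ^ p - a i ^ p) :=
    Finset.sum_le_sum fun i hi => rpow_tangent (ha0 i (Finset.mem_range.1 hi))
      (hb0 i (Finset.mem_range.1 hi)) hp
  rw [Finset.sum_sub_distrib] at h2
  linarith

lemma median_step (f : ℝ → ℝ) (x y c : ℝ) (h : y ≤ x) :
    f (max y (min x c)) + f (min y c) = f y + f (min x c) := by
  rcases le_total y c with h1 | h1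
  · rw [min_eq_left h1, max_eq_right (le_min h h1)]; ring
  · rw [min_eq_right h1, min_eq_right (h1.trans h), max_eq_left h1]

lemma median_sum (f : ℝ → ℝ) (t : ℕ → ℝ) (ht : Antitone t) (c : ℝ) (hc : c ≤ t 1) (k : ℕ) :
    ∑ i ∈ Finset.range k, f (max (t (i+2)) (min (t (i+1)) c)) + f (min (t (k+1)) c)
      = ∑ i ∈ Finset.range k, f (t (i+2)) + f c := by
  induction k with
  | zero => simp [min_eq_right hc]
  | succ k ih =>
    rw [Finset.sum_range_succ, Finset.sum_range_succ (fun i => f (t (i+2)))]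
    have := median_step f (t (k+1)) (t (k+2)) c (ht (by omega))
    have e : k + 1 + 1 = k + 2 := rfl
    rw [e]
    linarith

lemma real_part (lam θ : ℕ → ℝ) (hθ_mono : Antitone θ) (r : ℕ) (hr : 2 ≤ r)
    (hpos : ∀ i < r, 0 < θ i) (h0 : θ 0 ≤ lam 0)
    (hint : ∀ i, i + 1 < r → θ (i+1) ≤ lam i)
    (hky : ∀ k ≤ r, ∑ i ∈ Finset.range k, θ i - 1 ≤ ∑ i ∈ Finset.range k, lam i)
    (p : ℝ) (hp : 1 ≤ p) :
      lam 0 ^ p + ∑ k ∈ Finset.Ico 1 r, max (lam k) 0 ^ p ≥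
        (∑ k ∈ Finset.range r, θ k ^ p) + max (θ 1 - 1) 0 ^ p - θ 1 ^ p := by
  obtain ⟨m, rfl⟩ : ∃ m, r = m + 1 := ⟨r - 1, by omega⟩
  set c := max (θ 1 - 1) 0 with hc
  have hc0 : 0 ≤ c := le_max_right _ _
  set t : ℕ → ℝ := fun i => if i < m + 1 then θ i else 0 with ht
  have htl : ∀ i, i < m + 1 → t i = θ i := fun i hi => by simp only [ht]; rw [if_pos hi]
  have htg : ∀ i, ¬ i < m + 1 → t i = 0 := fun i hi => by simp only [ht]; rw [if_neg hi]
  have htm : Antitone t := by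
    intro i j hij
    by_cases hj : j < m + 1
    · rw [htl j hj, htl i (by omega)]; exact hθ_mono hij
    · rw [htg j hj]
      by_cases hi : i < m + 1
      · rw [htl i hi]; exact (hpos i hi).le
      · rw [htg i hi]
  have ht0 : ∀ i, 0 ≤ t i := fun i => by
    by_cases hi : i < m + 1
    · rw [htl i hi]; exact (hpos i hi).le
    · rw [htg i hi]
  have ht1 : t 1 = θ 1 := htl 1 (by omega)
  have hct : c ≤ t 1 := by
    rw [ht1]; exact max_le (by linarith) (hpos 1 (by omega)).le
  let a' : ℕ → ℝ := fun i => max (t (i+2)) (min (t (i+1)) c)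
  let a : ℕ → ℝ := fun i => Nat.casesOn i (θ 0) a'
  let b : ℕ → ℝ := fun i => Nat.casesOn i (lam 0) (fun i => max (lam (i+1)) 0)
  have ha0 : a 0 = θ 0 := rfl
  have hb0 : b 0 = lam 0 := rfl
  have ha' : ∀ i, a (i+1) = max (t (i+2)) (min (t (i+1)) c) := fun i => rfl
  have hb' : ∀ i, b (i+1) = max (lam (i+1)) 0 := fun i => rfl
  have main := weak_major a b (m+1) ?_ ?_ ?_ ?_ p hp
  · rw [Finset.sum_range_succ', Finset.sum_range_succ', ha0, hb0] at main
    simp only [ha', hb'] at main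
    have e1 := median_sum (fun x => x ^ p) t htm c hct m
    rw [htg (m+1) (by omega), min_eq_left hc0] at e1
    have e2 := Finset.sum_range_succ (fun i => t (i+1) ^ p) m
    rw [Finset.sum_range_succ', htg (m+1) (by omega), zero_add, ht1] at e2
    rw [Finset.sum_Ico_eq_sum_range, Finset.sum_range_succ' (fun k => θ k ^ p)]
    have e3 : ∑ i ∈ Finset.range m, t (i+1) ^ p = ∑ i ∈ Finset.range m, θ (i+1) ^ p :=
      Finset.sum_congr rfl fun i hi => by
        rw [htl (i+1) (by have := Finset.mem_range.1 hi; omega)]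
    simp only [add_tsub_cancel_right, add_comm 1]
    simp only [add_assoc, Nat.reduceAdd] at e1 e2
    linarith
  · rintro (_ | i) hi
    · exact (hpos 0 (by omega)).le
    · rw [ha']; exact le_max_of_le_left (ht0 _)
  · rintro (_ | i) hi
    · exact (hpos 0 (by omega)).le.trans h0
    · rw [hb']; exact le_max_right _ _
  · rintro (_ | i) hi
    · rw [ha0, ha', ← htl 0 (by omega)]
      exact max_le (htm (by omega)) ((min_le_left _ _).trans (htm (by omega)))
    · rw [ha', ha']
      refine max_le ?_ ?_
      · exact le_max_of_le_left (htm (by omega))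
      · exact le_max_of_le_left (min_le_left _ _)
  · rintro (_ | k) hk
    · simp
    rw [Finset.sum_range_succ', Finset.sum_range_succ', ha0, hb0]
    simp only [ha', hb']
    have e1 := median_sum (fun x => x) t htm c hct k
    rcases le_or_gt c (t (k+1)) with h | h
    · rw [min_eq_right h] at e1
      have : ∑ i ∈ Finset.range k, t (i+2) ≤ ∑ i ∈ Finset.range k, max (lam (i+1)) 0 := by
        refine Finset.sum_le_sum fun i hi => ?_
        by_cases hi2 : i + 2 < m + 1
        · rw [htl _ hi2]; exact le_max_of_le_left (hint (i+1) hi2)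
        · rw [htg _ hi2]; exact le_max_right _ _
      linarith
    · rw [min_eq_left h.le] at e1
      have hcv : c = θ 1 - 1 := by
        rcases max_choice (θ 1 - 1) 0 with h' | h'
        · exact h'
        · have := ht0 (k+1)
          rw [← hc] at h'
          linarith
      have e2 := Finset.sum_range_succ (fun i => t (i+1)) k
      rw [Finset.sum_range_succ', zero_add, ht1] at e2
      simp only [add_assoc, Nat.reduceAdd] at e2
      have e3 : ∑ i ∈ Finset.range k, t (i+1) = ∑ i ∈ Finset.range k, θ (i+1) :=
        Finset.sum_congr rfl fun i hi => by
          rw [htl (i+1) (by have := Finset.mem_range.1 hi; omega)]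
      have e4 := hky (k+1) hk
      rw [Finset.sum_range_succ', Finset.sum_range_succ'] at e4
      have e5 : ∑ i ∈ Finset.range k, lam (i+1) ≤ ∑ i ∈ Finset.range k, max (lam (i+1)) 0 :=
        Finset.sum_le_sum fun i _ => le_max_left _ _
      linarith

lemma inner_toEuclideanLin {n : ℕ} (A : Matrix (Fin n) (Fin n) ℝ)
    (z : EuclideanSpace ℝ (Fin n)) :
    inner ℝ z (Matrix.toEuclideanLin A z) = ∑ i, ∑ j, A i j * (z i * z j) := by
  simp only [PiLp.inner_apply, Matrix.toLpLin_apply, Matrix.mulVec, dotProduct]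
  refine Finset.sum_congr rfl fun i _ => ?_
  simp only [RCLike.inner_apply, conj_trivial, Finset.sum_mul]
  refine Finset.sum_congr rfl fun j _ => ?_
  ring

lemma adjMat_apply' {n : ℕ} (G : SimpleGraph (Fin n)) (i j : Fin n) [Decidable (G.Adj i j)] :
    adjMat G i j = if G.Adj i j then 1 else 0 := by
  simp only [adjMat, SimpleGraph.adjMatrix_apply]
  congr

lemma adjMat_herm {n : ℕ} (G : SimpleGraph (Fin n)) : (adjMat G).IsHermitian := by
  classical
  ext i j
  simp [Matrix.conjTranspose_apply, adjMat_apply', G.adj_comm]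

lemma adjMat_split {n : ℕ} (G : SimpleGraph (Fin n)) (x y : Fin n) (h : G.Adj x y) :
    adjMat G = adjMat (G.deleteEdges {s(x,y)}) + Matrix.single x y 1 + Matrix.single y x 1 := by
  classical
  ext i j
  have hne := h.ne
  have h' := h.symm
  simp only [Matrix.add_apply, adjMat_apply', SimpleGraph.deleteEdges_adj, Matrix.single_apply,
    Set.mem_singleton_iff, Sym2.eq_iff]
  by_cases h1 : x = i ∧ y = j
  · obtain ⟨rfl, rfl⟩ := h1
    simp [h, hne, hne.symm]
  · by_cases h2 : y = i ∧ x = j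
    · obtain ⟨rfl, rfl⟩ := h2
      simp [h', hne, hne.symm]
    · have h3 : ¬ (i = x ∧ j = y ∨ i = y ∧ j = x) := by grind
      simp [h1, h2, h3]

lemma quad_split {n : ℕ} (G : SimpleGraph (Fin n)) (x y : Fin n) (h : G.Adj x y)
    (z : EuclideanSpace ℝ (Fin n)) :
    inner ℝ z (Matrix.toEuclideanLin (adjMat G) z) =
      inner ℝ z (Matrix.toEuclideanLin (adjMat (G.deleteEdges {s(x,y)})) z) + 2 * (z x * z y) := by
  rw [adjMat_split G x y h, inner_toEuclideanLin, inner_toEuclideanLin]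
  simp only [Matrix.add_apply, add_mul, Finset.sum_add_distrib]
  have aux : ∀ x y : Fin n,
      ∑ i, ∑ j, (Matrix.single x y (1:ℝ)) i j * (z i * z j) = z x * z y := by
    intro x y
    rw [Finset.sum_eq_single x, Finset.sum_eq_single y] <;>
      simp +contextual [Matrix.single_apply, eq_comm]
  rw [aux, aux]; ring

/-- Let `G` be a simple graph on `n` vertices, `e ∈ E(G)`, `H = G - e`,
with `lam` and `θ` the nonincreasing lists of eigenvalues of `A(G)` and `A(H)` (0-indexed,
so `θ 1 = θ₂`). Suppose `H` has exactly `r ≥ 2` positive eigenvalues. Then for every real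
`p ≥ 1`, `λ₁^p + Σ_{k=2}^r max{λ_k, 0}^p ≥ (Σ_{k=1}^r θ_k^p) + max{θ₂ - 1, 0}^p - θ₂^p`. -/
theorem majorization_p_power_sum {n : ℕ}
    (G H : SimpleGraph (Fin n)) (e : Sym2 (Fin n)) (he : e ∈ G.edgeSet)
    (hH : H = G.deleteEdges {e})
    (lam θ : ℕ → ℝ) (hlam_mono : Antitone lam) (hθ_mono : Antitone θ)
    (hlam : (adjMat G).charpoly.roots = (Multiset.range n).map lam)
    (hθ : (adjMat H).charpoly.roots = (Multiset.range n).map θ)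
    (r : ℕ) (hr : 2 ≤ r)
    (hrcard : ((Finset.range n).filter (fun i => 0 < θ i)).card = r) :
    ∀ p : ℝ, 1 ≤ p →
      lam 0 ^ p + ∑ k ∈ Finset.Ico 1 r, max (lam k) 0 ^ p ≥
        (∑ k ∈ Finset.range r, θ k ^ p) + max (θ 1 - 1) 0 ^ p - θ 1 ^ p := by
  subst hH
  induction e using Sym2.ind with
  | _ x y =>
  have hxy : G.Adj x y := he
  obtain ⟨v, hv⟩ := exists_eigenbasis _ (adjMat_herm G) lam hlam_mono hlam
  obtain ⟨u, hu⟩ := exists_eigenbasis _ (adjMat_herm _) θ hθ_mono hθ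
  set T := Matrix.toEuclideanLin (adjMat G) with hT
  set S := Matrix.toEuclideanLin (adjMat (G.deleteEdges {s(x,y)})) with hS
  have hq : ∀ z, inner ℝ z (T z) = inner ℝ z (S z) + 2 * (z x * z y) := quad_split G x y hxy
  have hrn : r ≤ n := by
    rw [← hrcard]; exact (Finset.card_filter_le _ _).trans (by simp)
  have hpos : ∀ i < r, 0 < θ i := by
    intro i hi
    by_contra hneg
    have : (Finset.range n).filter (fun i => 0 < θ i) ⊆ Finset.range i := by
      intro j hj
      rw [Finset.mem_filter] at hj
      rw [Finset.mem_range]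
      by_contra hji
      have := hθ_mono (not_lt.1 hji)
      linarith [hj.2]
    have := Finset.card_le_card this
    rw [hrcard, Finset.card_range] at this
    omega
  have hSu : ∀ i : Fin n, inner ℝ (u i) (S (u i)) = θ i := by
    intro i
    rw [hu, inner_smul_right, real_inner_self_eq_norm_sq, u.norm_eq_one]; simp
  refine real_part lam θ hθ_mono r hr hpos ?_ ?_ ?_
  · -- Perron
    classical
    let i0 : Fin n := ⟨0, by omega⟩
    let z : EuclideanSpace ℝ (Fin n) := WithLp.toLp 2 fun i => |u i0 i|
    have hz : ‖z‖ = 1 := by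
      rw [← u.norm_eq_one i0, EuclideanSpace.norm_eq, EuclideanSpace.norm_eq]
      simp only [z, Real.norm_eq_abs, abs_abs]
    have h1 : θ 0 ≤ inner ℝ z (T z) := by
      have e : θ 0 = inner ℝ (u i0) (S (u i0)) := (hSu i0).symm
      rw [hq, e, hS, inner_toEuclideanLin, inner_toEuclideanLin]
      have : 0 ≤ 2 * (z x * z y) := by simp only [z]; positivity
      refine le_trans ?_ (le_add_of_nonneg_right this)
      refine Finset.sum_le_sum fun i _ => Finset.sum_le_sum fun j _ => ?_
      refine mul_le_mul_of_nonneg_left ?_ ?_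
      · simp only [z]; rw [← abs_mul]; exact le_abs_self _
      · rw [adjMat_apply']; split_ifs <;> norm_num
    rw [quad_eq T v lam hv] at h1
    have h2 : ∑ j : Fin n, lam j * inner ℝ z (v j) ^ 2 ≤ lam 0 * ‖z‖^2 := by
      rw [← v.sum_sq_inner_left z, Finset.mul_sum]
      exact Finset.sum_le_sum fun j _ =>
        mul_le_mul_of_nonneg_right (hlam_mono (by omega)) (sq_nonneg _)
    rw [hz] at h2
    linarith
  · intro i hi
    refine interlace S T v u lam θ hlam_mono hθ_mono hv hu
      (innerₛₗ ℝ (EuclideanSpace.single x (1:ℝ))) ?_ i (by omega)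
    intro z hz
    have hz' : z x = 0 := by simpa [EuclideanSpace.inner_single_left] using hz
    rw [hq, hz']; ring
  · intro k hk
    set s : Finset (Fin n) := Finset.univ.filter fun i => i.1 < k with hs
    have hsum : ∀ f : ℕ → ℝ, ∑ i ∈ Finset.range k, f i = ∑ i ∈ s, f i := by
      intro f
      symm
      refine Finset.sum_bij (fun i _ => i.1) ?_ ?_ ?_ ?_
      · intro i hi; simpa [hs] using hi
      · intro i _ j _ h; exact Fin.ext h
      · intro j hj
        have hj' := Finset.mem_range.1 hj
        exact ⟨⟨j, by omega⟩, by simpa [hs] using hj', rfl⟩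
      · intro i _; rfl
    rw [hsum, hsum]
    refine le_trans ?_ (kyfan T v u lam hlam_mono hv s k (by simp [hs]))
    simp_rw [hq, hSu]
    rw [Finset.sum_add_distrib]
    set w : EuclideanSpace ℝ (Fin n) :=
      EuclideanSpace.single x (1:ℝ) - EuclideanSpace.single y (1:ℝ) with hw
    have hwi : ∀ i, inner ℝ (u i) w = u i x - u i y := by
      intro i
      simp [hw, inner_sub_right, EuclideanSpace.inner_single_right]
    have hwn : ‖w‖ ^ 2 = 2 := by
      rw [← real_inner_self_eq_norm_sq]
      nth_rewrite 2 [hw]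
      rw [inner_sub_right]
      simp [hw, EuclideanSpace.inner_single_right, hxy.ne, hxy.ne.symm]
      norm_num
    have hB := u.orthonormal.sum_inner_products_le w (s := s)
    rw [hwn] at hB
    simp only [Real.norm_eq_abs, sq_abs, hwi] at hB
    have h3 : ∑ i ∈ s, -((u i x - u i y)^2 / 2) ≤ ∑ i ∈ s, 2 * (u i x * u i y) :=
      Finset.sum_le_sum fun i _ => by nlinarith [sq_nonneg (u i x + u i y)]
    rw [Finset.sum_neg_distrib, ← Finset.sum_div] at h3
    linarith
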